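/- For every N ∈ GL(n,2) there exists a finite sequence of transvections T_{i₁,j₁}, …, T_{iₖ,jₖ} whose product equals N and which uses only essential indices of N, i.e., {i_t, j_t} ⊆ ε(N) for every t = 1, …, k. -/

import Mathlib

/-- The set of essential indices of a matrix: `i` is essential if some off-diagonal
entry in row `i` or column `i` equals `1`. -/
def essential {k : ℕ} (M : Matrix (Fin k) (Fin k) (ZMod 2)) : Set (Fin k) :=
  {i | ∃ j, j ≠ i ∧ (M i j = 1 ∨ M j i = 1)}

theorem ZMod.two_eq_one_of_ne_zero {a : ZMod 2} (ha : a ≠ 0) : a = 1 :=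
  Fin.eq_one_of_ne_zero a ha

open Matrix TransvectionStruct in
/-- Over `ZMod 2`, every matrix of nonzero determinant is a product of transvections. -/
theorem exists_list_transvec_prod_eq_of_det_ne_zero {m : Type*} [Fintype m] [DecidableEq m]
    (A : Matrix m m (ZMod 2)) (hA : A.det ≠ 0) :
    ∃ L : List (TransvectionStruct m (ZMod 2)), (L.map toMatrix).prod = A := by
  refine diagonal_transvection_induction_of_det_ne_zero
    (fun A => ∃ L : List (TransvectionStruct m (ZMod 2)), (L.map toMatrix).prod = A) A hA
    ?_ ?_ ?_
  · intro D hD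
    refine ⟨[], ?_⟩
    have h : D = 1 := by
      funext i
      rw [det_diagonal, Finset.prod_ne_zero_iff] at hD
      exact ZMod.two_eq_one_of_ne_zero (hD i (Finset.mem_univ i))
    simp [h]
  · exact fun t => ⟨[t], by simp⟩
  · rintro A B - - ⟨L, rfl⟩ ⟨L', rfl⟩
    exact ⟨L ++ L', by simp⟩

open Matrix TransvectionStruct in
/-- Over `ZMod 2`, a product of transvections can be written using only those with
coefficient `1`. -/
theorem exists_list_transvection_one_prod_eq {m : Type*} [Fintype m] [DecidableEq m]
    (L : List (TransvectionStruct m (ZMod 2))) (S : Set m) (hS : ∀ t ∈ L, t.i ∈ S ∧ t.j ∈ S) :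
    ∃ L' : List (m × m), (∀ p ∈ L', p.1 ≠ p.2) ∧
      (L'.map fun p => transvection p.1 p.2 (1 : ZMod 2)).prod = (L.map toMatrix).prod ∧
      ∀ p ∈ L', p.1 ∈ S ∧ p.2 ∈ S := by
  induction L with
  | nil => exact ⟨[], by simp⟩
  | cons t L ih =>
    obtain ⟨L', hne, hprod, hmem⟩ := ih fun u hu => hS u (List.mem_cons_of_mem _ hu)
    by_cases hc : t.c = 0
    · exact ⟨L', hne, by simp [hprod, toMatrix, hc], hmem⟩
    · refine ⟨(t.i, t.j) :: L', ?_, ?_, ?_⟩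
      · exact List.forall_mem_cons.2 ⟨t.hij, hne⟩
      · simp [hprod, toMatrix, ZMod.two_eq_one_of_ne_zero hc]
      · exact List.forall_mem_cons.2 ⟨hS t List.mem_cons_self, hmem⟩

/-- A row or column through a non-essential index vanishes off the diagonal. -/
theorem apply_eq_zero_of_notMem_essential {k : ℕ} {M : Matrix (Fin k) (Fin k) (ZMod 2)}
    {i j : Fin k} (hi : i ∉ essential M) (hij : j ≠ i) : M i j = 0 ∧ M j i = 0 := by
  constructor <;> by_contra h <;> refine hi ⟨j, hij, ?_⟩
  · exact Or.inl (ZMod.two_eq_one_of_ne_zero h)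
  · exact Or.inr (ZMod.two_eq_one_of_ne_zero h)

/-- A non-essential index of an invertible matrix has diagonal entry `1`. -/
theorem apply_self_eq_one_of_notMem_essential {k : ℕ} {M : Matrix (Fin k) (Fin k) (ZMod 2)}
    (hM : M.det ≠ 0) {i : Fin k} (hi : i ∉ essential M) : M i i = 1 := by
  refine ZMod.two_eq_one_of_ne_zero fun h => hM (Matrix.det_eq_zero_of_row_eq_zero i fun j => ?_)
  by_cases hij : j = i
  · rw [hij, h]
  · exact (apply_eq_zero_of_notMem_essential hi hij).1

theorem essential_indices_are_sufficient (n : ℕ) (N : GL (Fin n) (ZMod 2)) :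
    ∃ L : List (Fin n × Fin n),
      (∀ p ∈ L, p.1 ≠ p.2) ∧
      (L.map fun p => Matrix.transvection p.1 p.2 (1 : ZMod 2)).prod
        = (N : Matrix (Fin n) (Fin n) (ZMod 2)) ∧
      ∀ p ∈ L, p.1 ∈ essential (N : Matrix (Fin n) (Fin n) (ZMod 2)) ∧
        p.2 ∈ essential (N : Matrix (Fin n) (Fin n) (ZMod 2)) := by
  classical
  set M : Matrix (Fin n) (Fin n) (ZMod 2) := N.val
  have hM : M.det ≠ 0 := ((Matrix.isUnit_iff_isUnit_det _).1 N.isUnit).ne_zero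
  let e := Equiv.sumCompl (· ∈ essential M)
  let A : Matrix {i // i ∈ essential M} {i // i ∈ essential M} (ZMod 2) :=
    M.submatrix Subtype.val Subtype.val
  have hblocks : M.submatrix e e = Matrix.fromBlocks A 0 0 1 := by
    ext (a | a) (b | b)
    · simp [A, e]
    · simpa [e] using (apply_eq_zero_of_notMem_essential b.2 fun h => b.2 (h ▸ a.2)).2
    · simpa [e] using (apply_eq_zero_of_notMem_essential a.2 fun h => a.2 (h ▸ b.2)).1
    · by_cases hab : a = b
      · simpa [e, hab] using apply_self_eq_one_of_notMem_essential hM b.2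
      · simpa [e, hab] using
          (apply_eq_zero_of_notMem_essential b.2 fun h => hab (Subtype.ext h)).2
  have hA : A.det ≠ 0 := by
    have h := congrArg Matrix.det hblocks
    rw [Matrix.det_submatrix_equiv_self, Matrix.det_fromBlocks_zero₂₁, Matrix.det_one,
      mul_one] at h
    exact h ▸ hM
  obtain ⟨L, hL⟩ := exists_list_transvec_prod_eq_of_det_ne_zero A hA
  have hprod : ((L.map fun t => (t.sumInl _).reindexEquiv e).map
      Matrix.TransvectionStruct.toMatrix).prod = M := by
    have h := Matrix.TransvectionStruct.sumInl_toMatrix_prod_mul _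
      (1 : Matrix {i // i ∈ essential M} {i // i ∈ essential M} (ZMod 2)) L
      (1 : Matrix {i // i ∉ essential M} {i // i ∉ essential M} (ZMod 2))
    rw [Matrix.fromBlocks_one, mul_one, mul_one, hL, ← hblocks] at h
    have h' := Matrix.TransvectionStruct.toMatrix_reindexEquiv_prod e
      (L.map (Matrix.TransvectionStruct.sumInl {i // i ∉ essential M}))
    rw [List.map_map, List.map_map, h] at h'
    rw [List.map_map]
    refine h'.trans ?_
    ext i j
    simp
  rw [← hprod]
  refine exists_list_transvection_one_prod_eq _ _ fun t ht => ?_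
  obtain ⟨s, -, rfl⟩ := List.mem_map.1 ht
  rw [hprod]
  exact ⟨s.i.2, s.j.2⟩
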